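/- arXiv:1703.03201 — 2 statements merged into one kernel-verified Lean document; each statement's English description precedes it below -/
import Mathlib

section
/- Let G = (V, E) be a finite, nonempty, weakly connected directed graph that admits a level mapping μ, and set m = (max_{v ∈ V} μ v) − (min_{v ∈ V} μ v) (the difference of levels of G, which does not depend on the choice of μ). Let H = (W, F) be a downward forest. Then there is a homomorphism from G to H if and only if H contains a directed path of length m. -/
/-- If `h` is a homomorphism into a graph with in-degree at most one, the images of any two
weakly connected vertices have a common ancestor, reached by upward walks `q` and `r` whose
lengths differ by the difference of the levels. -/
theorem exists_common_ancestor_of_reflTransGen {V W : Type*} {E : V → V → Prop} {μ : V → ℤ}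
    (hμ : ∀ u v, E u v → μ v = μ u - 1) {F : W → W → Prop}
    (hin : ∀ ⦃u u' v : W⦄, F u v → F u' v → u = u')
    {h : V → W} (hh : ∀ u v, E u v → F (h u) (h v)) {u v : V}
    (huv : Relation.ReflTransGen (fun a b => E a b ∨ E b a) u v) :
    ∃ (q r : ℕ → W) (i j : ℕ), q 0 = h u ∧ r 0 = h v ∧ q i = r j ∧
      (∀ t < i, F (q (t + 1)) (q t)) ∧ (∀ t < j, F (r (t + 1)) (r t)) ∧
      μ v - μ u = (i : ℤ) - j := by
  induction huv with
  | refl => exact ⟨fun _ => h u, fun _ => h u, 0, 0, by simp⟩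
  | @tail v v' _ hvv' ih =>
    obtain ⟨q, r, i, j, hq0, hr0, hqr, hq, hr, hlev⟩ := ih
    rcases hvv' with hE | hE
    · refine ⟨q, fun t => Nat.casesOn t (h v') r, i, j + 1, hq0, rfl, hqr, hq, ?_, ?_⟩
      · rintro (_ | t) ht
        · simpa [hr0] using hh _ _ hE
        · exact hr t (by omega)
      · have := hμ _ _ hE
        push_cast
        omega
    · have hlev' := hμ _ _ hE
      rcases j with _ | j
      · refine ⟨fun t => if t ≤ i then q t else h v', fun _ => h v', i + 1, 0,
          by simpa using hq0, rfl, by simp, ?_, by simp, by push_cast at *; omega⟩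
        intro t ht
        rcases Nat.lt_succ_iff_lt_or_eq.mp ht with hlt | rfl
        · simpa [hlt.le, Nat.succ_le_of_lt hlt] using hq t hlt
        · simpa [hqr, hr0] using hh _ _ hE
      · refine ⟨q, fun t => r (t + 1), i, j, hq0, ?_, hqr, hq,
          fun t ht => hr (t + 1) (by omega), by push_cast at *; omega⟩
        have h0 := hr 0 (by omega)
        rw [hr0] at h0
        exact hin h0 (hh _ _ hE)

/-- The vertices of an upward walk are related by the transitive closure of the edge relation. -/
theorem transGen_of_upward_walk {W : Type*} {F : W → W → Prop} {q : ℕ → W} {n : ℕ}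
    (hq : ∀ t < n, F (q (t + 1)) (q t)) {a b : ℕ} (hab : a < b) (hb : b ≤ n) :
    Relation.TransGen F (q b) (q a) := by
  induction b, hab using Nat.le_induction with
  | base => exact .single (hq a (by omega))
  | succ b _ ih => exact .head (hq b (by omega)) (ih (by omega))


/-- Let `G = (V, E)` be finite, nonempty, weakly connected, with a level
mapping `μ`, and let `m = max μ - min μ` be its difference of levels. Let `H = (W, F)` be
a downward forest (finite, acyclic, every vertex with at most one in-neighbor). Then
`G ⤳ H` iff `H` contains a directed path of length `m`. -/
theorem stmt_9 {V : Type} [Fintype V] [Nonempty V] (E : V → V → Prop)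
    (hconn : ∀ u v : V, Relation.ReflTransGen (fun a b => E a b ∨ E b a) u v)
    (μ : V → ℤ) (hμ : ∀ u v, E u v → μ v = μ u - 1)
    (m : ℕ)
    (hm : (m : ℤ) = Finset.univ.sup' Finset.univ_nonempty μ
        - Finset.univ.inf' Finset.univ_nonempty μ)
    {W : Type} [Fintype W] (F : W → W → Prop)
    (hacyc : ∀ w : W, ¬ Relation.TransGen F w w)
    (hin : ∀ ⦃u u' v : W⦄, F u v → F u' v → u = u') :
    (∃ h : V → W, ∀ u v, E u v → F (h u) (h v)) ↔
    (∃ p : Fin (m + 1) → W, Function.Injective p ∧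
        ∀ i : Fin m, F (p i.castSucc) (p i.succ)) := by
  constructor
  · rintro ⟨h, hh⟩
    obtain ⟨x, -, hx⟩ := Finset.exists_mem_eq_sup' Finset.univ_nonempty μ
    obtain ⟨u, -, hu⟩ := Finset.exists_mem_eq_inf' Finset.univ_nonempty μ
    obtain ⟨q, r, i, j, -, -, -, hq, -, hlev⟩ :=
      exists_common_ancestor_of_reflTransGen hμ hin hh (hconn u x)
    have hmi : m ≤ i := by omega
    refine ⟨fun k => q (m - k), fun a b hab => ?_, fun k => ?_⟩
    · have ha := a.isLt
      have hb := b.isLt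
      have hab' : q (m - a) = q (m - b) := hab
      by_contra hne
      have hne' : (a : ℕ) ≠ b := fun e => hne (Fin.ext e)
      rcases Nat.lt_or_gt_of_ne (show m - (a : ℕ) ≠ m - b by omega) with hlt | hlt
      · have := transGen_of_upward_walk hq hlt (by omega)
        rw [hab'] at this
        exact hacyc _ this
      · have := transGen_of_upward_walk hq hlt (by omega)
        rw [hab'] at this
        exact hacyc _ this
    · have hk := k.isLt
      have := hq (m - (k + 1)) (by omega)
      rwa [show m - ((k : ℕ) + 1) + 1 = m - k by omega] at this
  · rintro ⟨p, -, hp⟩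
    set M := Finset.univ.sup' Finset.univ_nonempty μ
    have hM : ∀ v, μ v ≤ M := fun v => Finset.le_sup' μ (Finset.mem_univ v)
    have hL : ∀ v, M - m ≤ μ v := fun v => by
      have := Finset.inf'_le μ (Finset.mem_univ v)
      omega
    refine ⟨fun v => p ⟨(M - μ v).toNat, by have := hM v; have := hL v; omega⟩, ?_⟩
    intro u v huv
    have h1 := hμ u v huv
    have h2 := hM u
    have h3 := hL v
    have h4 := hp ⟨(M - μ u).toNat, by omega⟩
    have h5 : (M - μ v).toNat = (M - μ u).toNat + 1 := by omega
    simpa only [h5, Fin.castSucc_mk, Fin.succ_mk] using h4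
end

section
/- Let G = (V, E) be a nonempty downward forest, and let m be the maximal length of a directed path in G. Then there are homomorphisms G ⤳ P_m and P_m ⤳ G; consequently, for every directed graph H, G ⤳ H if and only if P_m ⤳ H. -/
/-- A walk in an acyclic relation visits pairwise distinct vertices. -/
theorem injective_of_walk {V : Type*} {E : V → V → Prop}
    (hacyc : ∀ v : V, ¬ Relation.TransGen E v v) {k : ℕ} {p : Fin (k + 1) → V}
    (hp : ∀ i : Fin k, E (p i.castSucc) (p i.succ)) : Function.Injective p := by
  have hlt : ∀ i j, i < j → Relation.TransGen E (p i) (p j) := fun _ _ h =>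
    (Fin.liftFun_iff_succ (Relation.TransGen E)).2 (fun i => .single (hp i)) h
  intro i j hij
  rcases lt_trichotomy i j with h | h | h
  · exact (hacyc (p j) (hij ▸ hlt i j h)).elim
  · exact h
  · exact (hacyc (p j) (hij ▸ hlt j i h)).elim

/-- In a finite downward forest there is a depth function: it increases by one along edges, and
each vertex of positive depth has an in-neighbor. -/
theorem exists_depth {V : Type*} [Finite V] {E : V → V → Prop}
    (hacyc : ∀ v : V, ¬ Relation.TransGen E v v)
    (hin : ∀ ⦃u u' v : V⦄, E u v → E u' v → u = u') :
    ∃ d : V → ℕ, (∀ u v, E u v → d v = d u + 1) ∧ ∀ v, d v ≠ 0 → ∃ u, E u v := by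
  classical
  have : Std.Irrefl (Relation.TransGen E) := ⟨hacyc⟩
  have wf : WellFounded E := Subrelation.wf Relation.TransGen.single
    (Finite.wellFounded_of_trans_of_irrefl (Relation.TransGen E))
  let step : ∀ v, (∀ u, E u v → ℕ) → ℕ := fun v ih =>
    if h : ∃ u, E u v then ih h.choose h.choose_spec + 1 else 0
  refine ⟨wf.fix step, fun u v huv => ?_, fun v hv => ?_⟩
  · have h : ∃ u, E u v := ⟨u, huv⟩
    rw [wf.fix_eq step v]
    simp only [step, dif_pos h]
    rw [hin h.choose_spec huv]
  · by_contra h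
    rw [wf.fix_eq step v] at hv
    exact hv (dif_neg h)

/-- Each vertex is the end of a walk whose length is its depth. -/
theorem exists_walk_of_depth {V : Type*} {E : V → V → Prop} {d : V → ℕ}
    (hd : ∀ u v, E u v → d v = d u + 1) (hpos : ∀ v, d v ≠ 0 → ∃ u, E u v) (n : ℕ) (v : V)
    (hv : d v = n) :
    ∃ p : Fin (n + 1) → V, p (Fin.last n) = v ∧ ∀ i : Fin n, E (p i.castSucc) (p i.succ) := by
  induction n generalizing v with
  | zero => exact ⟨fun _ => v, rfl, fun i => i.elim0⟩
  | succ n ih =>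
    obtain ⟨u, huv⟩ := hpos v (by omega)
    obtain ⟨p, hpu, hp⟩ := ih u (by have := hd u v huv; omega)
    refine ⟨Fin.snoc p v, Fin.snoc_last _ _, fun i => ?_⟩
    cases i using Fin.lastCases with
    | last => rw [Fin.succ_last, Fin.snoc_last, Fin.snoc_castSucc, hpu]; exact huv
    | cast i => rw [Fin.succ_castSucc, Fin.snoc_castSucc, Fin.snoc_castSucc]; exact hp i

/-- If `G = (V, E)` is a nonempty downward forest (finite, acyclic, every
vertex with at most one in-neighbor) and `m` is the maximal length of a directed path in
`G`, then `G ⤳ P_m` and `P_m ⤳ G`; consequently, for every directed graph `H`,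
`G ⤳ H` iff `P_m ⤳ H`. -/
theorem stmt_10 {V : Type} [Fintype V] [Nonempty V] (E : V → V → Prop)
    (hacyc : ∀ v : V, ¬ Relation.TransGen E v v)
    (hin : ∀ ⦃u u' v : V⦄, E u v → E u' v → u = u')
    (m : ℕ)
    (hex : ∃ p : Fin (m + 1) → V, Function.Injective p ∧
        ∀ i : Fin m, E (p i.castSucc) (p i.succ))
    (hmax : ∀ k : ℕ, (∃ p : Fin (k + 1) → V, Function.Injective p ∧
        ∀ i : Fin k, E (p i.castSucc) (p i.succ)) → k ≤ m) :
    (∃ h : V → Fin (m + 1), ∀ u v, E u v → (h v : ℕ) = (h u : ℕ) + 1) ∧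
    (∃ h : Fin (m + 1) → V, ∀ i j : Fin (m + 1), (j : ℕ) = (i : ℕ) + 1 → E (h i) (h j)) ∧
    (∀ (X : Type) (F : X → X → Prop),
      (∃ h : V → X, ∀ u v, E u v → F (h u) (h v)) ↔
      (∃ h : Fin (m + 1) → X, ∀ i j : Fin (m + 1), (j : ℕ) = (i : ℕ) + 1 → F (h i) (h j))) := by
  have hto : ∃ h : V → Fin (m + 1), ∀ u v, E u v → (h v : ℕ) = (h u : ℕ) + 1 := by
    obtain ⟨d, hd, hpos⟩ := exists_depth hacyc hin
    have hle : ∀ v, d v ≤ m := fun v => by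
      obtain ⟨p, -, hp⟩ := exists_walk_of_depth hd hpos (d v) v rfl
      exact hmax _ ⟨p, injective_of_walk hacyc hp, hp⟩
    exact ⟨fun v => ⟨d v, Nat.lt_succ_of_le (hle v)⟩, hd⟩
  have hfrom : ∃ h : Fin (m + 1) → V,
      ∀ i j : Fin (m + 1), (j : ℕ) = (i : ℕ) + 1 → E (h i) (h j) := by
    obtain ⟨p, -, hp⟩ := hex
    refine ⟨p, fun i j hij => ?_⟩
    let k : Fin m := ⟨i, by omega⟩
    have hi : i = k.castSucc := rfl
    have hj : j = k.succ := Fin.ext hij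
    rw [hi, hj]
    exact hp k
  refine ⟨hto, hfrom, fun X F => ⟨?_, ?_⟩⟩
  · rintro ⟨g, hg⟩
    obtain ⟨h, hh⟩ := hfrom
    exact ⟨g ∘ h, fun i j hij => hg _ _ (hh i j hij)⟩
  · rintro ⟨g, hg⟩
    obtain ⟨h, hh⟩ := hto
    exact ⟨g ∘ h, fun u v huv => hg _ _ (hh u v huv)⟩
end
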